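/- Let d ≥ 1, let D ⊆ ℝ^d be a nonempty compact set, let λ > 0, and let G be a function assigning to each nonempty compact subset of D a nonnegative real number, which is lower semicontinuous with respect to Hausdorff convergence: whenever nonempty compact sets K_n ⊆ D converge in Hausdorff distance to a nonempty compact K ⊆ D, one has G(K) ≤ liminf_{n→∞} G(K_n). Then the minimum of Σ ↦ G(Σ) + λ · card(Σ) over all nonempty finite subsets Σ of D is attained: there exists a nonempty finite Σ* ⊆ D with G(Σ*) + λ card(Σ*) ≤ G(Σ) + λ card(Σ) for every nonempty finite Σ ⊆ D. -/

import Mathlib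

open Filter Set Topology

/-- Ranges of two finite families are at Hausdorff distance at most the sup distance
of the families. -/
theorem hausdorffDist_range_le_dist {ι α : Type*} [Fintype ι] [PseudoMetricSpace α]
    (f g : ι → α) : Metric.hausdorffDist (range f) (range g) ≤ dist f g := by
  refine Metric.hausdorffDist_le_of_mem_dist dist_nonneg ?_ ?_
  · rintro _ ⟨i, rfl⟩
    exact ⟨g i, mem_range_self i, dist_le_pi_dist f g i⟩
  · rintro _ ⟨i, rfl⟩
    exact ⟨f i, mem_range_self i, by rw [dist_comm]; exact dist_le_pi_dist f g i⟩

/-- A nonnegative set function that is sequentially lower semicontinuous for Hausdorff convergence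
of nonempty compact subsets of `D` gives a lower semicontinuous function of finite families
in `D`. -/
theorem lowerSemicontinuousOn_comp_range {ι α : Type*} [Fintype ι] [Nonempty ι]
    [PseudoMetricSpace α] {D : Set α} {G : Set α → ℝ}
    (hGnonneg : ∀ K, K ⊆ D → K.Nonempty → IsCompact K → 0 ≤ G K)
    (hGlsc : ∀ (K : ℕ → Set α) (L : Set α),
      (∀ n, K n ⊆ D) → (∀ n, (K n).Nonempty) → (∀ n, IsCompact (K n)) →
      L ⊆ D → L.Nonempty → IsCompact L →
      Tendsto (fun n => Metric.hausdorffDist (K n) L) atTop (𝓝 0) →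
      G L ≤ liminf (fun n => G (K n)) atTop) :
    LowerSemicontinuousOn (fun x : ι → α => G (range x)) (univ.pi fun _ => D) := by
  intro x hx y hy
  by_contra hnot
  have hfreq : ∃ᶠ z in 𝓝[univ.pi fun _ => D] x, G (range z) ≤ y :=
    (not_eventually.1 hnot).mono fun _ => le_of_not_gt
  obtain ⟨u, hu, huy⟩ := exists_seq_forall_of_frequently
    (hfreq.and_eventually self_mem_nhdsWithin)
  have range_subset {z : ι → α} (hz : z ∈ univ.pi fun _ => D) : range z ⊆ D :=
    range_subset_iff.2 fun i => hz i (mem_univ i)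
  have range_isCompact (z : ι → α) : IsCompact (range z) := (finite_range z).isCompact
  have hlim : Tendsto (fun n => Metric.hausdorffDist (range (u n)) (range x)) atTop (𝓝 0) :=
    squeeze_zero (fun _ => Metric.hausdorffDist_nonneg)
      (fun n => hausdorffDist_range_le_dist (u n) x)
      (tendsto_iff_dist_tendsto_zero.1 (hu.mono_right nhdsWithin_le_nhds))
  have hle := hGlsc (fun n => range (u n)) (range x) (fun n => range_subset (huy n).2)
    (fun n => range_nonempty _) (fun n => range_isCompact _) (range_subset hx)
    (range_nonempty _) (range_isCompact _) hlim
  have hliminf : liminf (fun n => G (range (u n))) atTop ≤ y :=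
    liminf_le_of_frequently_le (Frequently.of_forall fun n => (huy n).1)
      (isBoundedUnder_of ⟨0, fun n =>
        hGnonneg _ (range_subset (huy n).2) (range_nonempty _) (range_isCompact _)⟩)
  exact absurd hy (hle.trans hliminf).not_gt

/-- Existence of a minimizer of the penalized functional `G(Σ) + λ card(Σ)` over
nonempty finite subsets of a nonempty compact set `D ⊆ ℝ^d`, for `G` nonnegative
and lower semicontinuous with respect to Hausdorff convergence. -/
theorem exists_minimizer_finite_penalized
    (d : ℕ) (hd : 1 ≤ d)
    (D : Set (EuclideanSpace ℝ (Fin d))) (hDne : D.Nonempty) (hDc : IsCompact D)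
    (lam : ℝ) (hlam : 0 < lam)
    (G : Set (EuclideanSpace ℝ (Fin d)) → ℝ)
    (hGnonneg : ∀ K, K ⊆ D → K.Nonempty → IsCompact K → 0 ≤ G K)
    (hGlsc : ∀ (K : ℕ → Set (EuclideanSpace ℝ (Fin d)))
      (L : Set (EuclideanSpace ℝ (Fin d))),
      (∀ n, K n ⊆ D) → (∀ n, (K n).Nonempty) → (∀ n, IsCompact (K n)) →
      L ⊆ D → L.Nonempty → IsCompact L →
      Filter.Tendsto (fun n => Metric.hausdorffDist (K n) L) Filter.atTop (nhds 0) →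
      G L ≤ Filter.liminf (fun n => G (K n)) Filter.atTop) :
    ∃ S : Set (EuclideanSpace ℝ (Fin d)),
      S ⊆ D ∧ S.Nonempty ∧ S.Finite ∧
      ∀ T : Set (EuclideanSpace ℝ (Fin d)),
        T ⊆ D → T.Nonempty → T.Finite →
        G S + lam * (S.ncard : ℝ) ≤ G T + lam * (T.ncard : ℝ) := by
  have hmin (n : ℕ) : ∃ x ∈ univ.pi fun _ : Fin (n + 1) => D,
      IsMinOn (fun x => G (range x)) (univ.pi fun _ => D) x :=
    (lowerSemicontinuousOn_comp_range hGnonneg hGlsc).exists_isMinOn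
      (univ_pi_nonempty_iff.2 fun _ => hDne) (isCompact_univ_pi fun _ => hDc)
  choose x hxD hxmin using hmin
  have hsub (n : ℕ) : range (x n) ⊆ D := range_subset_iff.2 fun i => hxD n i (mem_univ i)
  have htop : Tendsto (fun n : ℕ => G (range (x n)) + lam * ((n : ℝ) + 1)) atTop atTop := by
    refine tendsto_atTop_mono (f := fun n : ℕ => lam * (n : ℝ)) (fun n => ?_)
      (tendsto_natCast_atTop_atTop.const_mul_atTop hlam)
    have := hGnonneg _ (hsub n) (range_nonempty _) (finite_range _).isCompact
    linarith
  obtain ⟨N, hN⟩ := (continuous_of_discreteTopology (f := fun n : ℕ =>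
    G (range (x n)) + lam * ((n : ℝ) + 1))).exists_forall_le (by simpa using htop)
  refine ⟨range (x N), hsub N, range_nonempty _, finite_range _, fun T hTD hTne hTfin => ?_⟩
  obtain ⟨m, hm⟩ : ∃ m, T.ncard = m + 1 :=
    Nat.exists_eq_add_one_of_ne_zero ((ncard_pos hTfin).2 hTne).ne'
  have : Finite T := hTfin
  let e : Fin (m + 1) ≃ T := (Finite.equivFinOfCardEq hm).symm
  have hrange : range (fun i => (e i : EuclideanSpace ℝ (Fin d))) = T := by
    rw [range_comp' Subtype.val e, e.range_eq_univ, image_univ, Subtype.range_coe]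
  have hGT : G (range (x m)) ≤ G T := by
    simpa only [hrange] using
      isMinOn_iff.1 (hxmin m) (fun i => (e i : EuclideanSpace ℝ (Fin d))) fun i _ => hTD (e i).2
  have hcard : ((range (x N)).ncard : ℝ) ≤ (N : ℝ) + 1 := by
    have : (range (x N)).ncard ≤ N + 1 := by
      rw [← image_univ]
      simpa using ncard_image_le (f := x N) finite_univ
    exact_mod_cast this
  calc G (range (x N)) + lam * ((range (x N)).ncard : ℝ)
      ≤ G (range (x N)) + lam * ((N : ℝ) + 1) := by gcongr
    _ ≤ G (range (x m)) + lam * ((m : ℝ) + 1) := hN m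
    _ ≤ G T + lam * (T.ncard : ℝ) := by
      rw [hm]
      push_cast
      gcongr
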